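/- Suppose (log n)^2/√n ≤ p ≤ 1 - (log n)^2/√n and let η > 0. Then for every r > 0, for all sufficiently large n, with probability at least 1 - 1/n^r, both the Eulerian extension number N_ext(G(n,p)) (minimum number of edge additions making the graph Eulerian) and the Eulerian reduction number N_red(G(n,p)) (minimum number of edge deletions making the graph Eulerian with at least one edge) lie between n/4 - n^{1/2+η} and n/4 + n^{1/2+η}. -/

import Mathlib

open MeasureTheory

/-- Bernoulli(p) measure on `Bool`. -/
noncomputable def bern (p : ℝ) : Measure Bool :=
  (Real.toNNReal p) • Measure.dirac true + (Real.toNNReal (1 - p)) • Measure.dirac false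

instance (p : ℝ) : IsFiniteMeasure (bern p) := by
  unfold bern; infer_instance

/-- The Erdős–Rényi measure: each potential edge (element of `Sym2 (Fin n)`)
is present (`true`) independently with probability `p`. -/
noncomputable def erMeasure (n : ℕ) (p : ℝ) : Measure (Sym2 (Fin n) → Bool) :=
  Measure.pi fun _ => bern p

/-- The random graph determined by the sample point `ω`. -/
def erGraph (n : ℕ) (ω : Sym2 (Fin n) → Bool) : SimpleGraph (Fin n) :=
  SimpleGraph.fromEdgeSet {e | ω e = true}

/-- Degree of a vertex. -/
noncomputable def degN {V : Type*} (G : SimpleGraph V) (v : V) : ℕ :=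
  Nat.card (G.neighborSet v)

/-- Number of odd-degree vertices. -/
noncomputable def oddCount (n : ℕ) (ω : Sym2 (Fin n) → Bool) : ℕ :=
  Nat.card {v : Fin n // Odd (degN (erGraph n ω) v)}

/-- A graph is Eulerian iff it is connected, every vertex has even degree,
and it has at least one edge. -/
def IsEulerian {V : Type*} (G : SimpleGraph V) : Prop :=
  G.Connected ∧ (∀ v, Even (degN G v)) ∧ G.edgeSet.Nonempty

/-- The minimum number of single-edge edits (additions or deletions) needed to
transform `G` into `H`: the size of the symmetric difference of edge sets. -/
noncomputable def editCount {V : Type*} (G H : SimpleGraph V) : ℕ :=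
  Nat.card ↥(symmDiff G.edgeSet H.edgeSet)

/-- Eulerian edit number: minimum number of single-edge additions/deletions
needed to turn `G` into an Eulerian graph. -/
noncomputable def Nedit {V : Type*} (G : SimpleGraph V) : ℕ :=
  sInf {k | ∃ H : SimpleGraph V, IsEulerian H ∧ editCount G H = k}

/-- Eulerian extension number: minimum number of edge additions making `G` Eulerian. -/
noncomputable def Next {V : Type*} (G : SimpleGraph V) : ℕ :=
  sInf {k | ∃ H : SimpleGraph V, IsEulerian H ∧ G ≤ H ∧ Nat.card ↥(H.edgeSet \ G.edgeSet) = k}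

/-- Eulerian reduction number: minimum number of edge deletions making `G` Eulerian
(with at least one edge remaining). -/
noncomputable def Nred {V : Type*} (G : SimpleGraph V) : ℕ :=
  sInf {k | ∃ H : SimpleGraph V, IsEulerian H ∧ H ≤ G ∧ Nat.card ↥(G.edgeSet \ H.edgeSet) = k}


/-- The mod-2 degree of `v` in the edge set `J`. -/
def bd {V : Type*} [DecidableEq V] (J : Finset (Sym2 V)) (v : V) : ZMod 2 :=
  ∑ e ∈ J, if v ∈ e then 1 else 0

/-- Any two disjoint vertex sets of sizes `a` and `b` are joined by an edge. -/
def Linked {V : Type*} (G : SimpleGraph V) (a b : ℕ) : Prop :=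
  ∀ A B : Finset V, Disjoint A B → A.card = a → B.card = b → ∃ x ∈ A, ∃ y ∈ B, G.Adj x y

section Deterministic

open Finset

variable {V : Type*}

lemma Linked.exists_adj {G : SimpleGraph V} {a b : ℕ} (h : Linked G a b) {A B : Finset V}
    (hd : Disjoint A B) (hA : a ≤ #A) (hB : b ≤ #B) : ∃ x ∈ A, ∃ y ∈ B, G.Adj x y := by
  obtain ⟨A', hA', hA''⟩ := exists_subset_card_eq hA
  obtain ⟨B', hB', hB''⟩ := exists_subset_card_eq hB
  obtain ⟨x, hx, y, hy, hxy⟩ := h A' B' (disjoint_of_subset_left hA'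
    (disjoint_of_subset_right hB' hd)) hA'' hB''
  exact ⟨x, hA' hx, y, hB' hy, hxy⟩

lemma degN_eq_degree [Fintype V] (G : SimpleGraph V) [DecidableRel G.Adj] (v : V) :
    degN G v = G.degree v := by
  rw [degN, Nat.card_eq_fintype_card, G.card_neighborSet_eq_degree]

lemma even_card_odd_degN [Fintype V] {G : SimpleGraph V} [DecidableRel G.Adj] (T : Finset V)
    (hT : ∀ v, v ∈ T ↔ Odd (degN G v)) : Even #T := by
  convert G.even_card_odd_degree_vertices using 2
  ext v
  simp [hT, degN_eq_degree]

variable [DecidableEq V]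

lemma bd_eq_card (J : Finset (Sym2 V)) (v : V) : bd J v = (#{e ∈ J | v ∈ e} : ZMod 2) := by
  simp [bd]

lemma bd_symmDiff (A B : Finset (Sym2 V)) (v : V) :
    bd (symmDiff A B) v = bd A v + bd B v := by
  unfold bd
  have hA := sum_inter_add_sum_sdiff A B (fun e => if v ∈ e then (1 : ZMod 2) else 0)
  have hB := sum_inter_add_sum_sdiff B A (fun e => if v ∈ e then (1 : ZMod 2) else 0)
  rw [← hA, ← hB, inter_comm B A, symmDiff_def, sup_eq_union, sum_union disjoint_sdiff_sdiff]
  linear_combination -CharTwo.add_self_eq_zero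
    (∑ e ∈ A ∩ B, if v ∈ e then (1 : ZMod 2) else 0)

lemma bd_singleton {u v : V} (h : u ≠ v) (w : V) :
    bd {s(u, v)} w = (if w = u then 1 else 0) + if w = v then 1 else 0 := by
  simp only [bd, sum_singleton, Sym2.mem_iff]
  by_cases h1 : w = u
  · subst h1; simp [h]
  · simp [h1]

lemma card_symmDiff_le {α : Type*} [DecidableEq α] (A B : Finset α) :
    #(symmDiff A B) ≤ #A + #B := by
  rw [symmDiff_def, sup_eq_union]
  exact (card_union_le _ _).trans (add_le_add (card_le_card sdiff_subset)
    (card_le_card sdiff_subset))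

lemma card_filter_symmDiff_le {α : Type*} [DecidableEq α] (A B : Finset α) (q : α → Prop)
    [DecidablePred q] :
    #{e ∈ symmDiff A B | q e} ≤ #{e ∈ A | q e} + #{e ∈ B | q e} := by
  refine (card_le_card ?_).trans (card_union_le _ _)
  intro e he
  simp only [mem_filter, mem_symmDiff, mem_union] at he ⊢
  tauto

lemma symmDiff_subset_of_subset {α : Type*} [DecidableEq α] {A B C : Finset α}
    (hA : A ⊆ C) (hB : B ⊆ C) : symmDiff A B ⊆ C := by
  intro e he
  rcases mem_symmDiff.1 he with h | h
  · exact hA h.1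
  · exact hB h.1

lemma card_le_two_mul_card_of_bd (D : Finset (Sym2 V)) (T : Finset V)
    (h : ∀ v ∈ T, bd D v ≠ 0) : #T ≤ 2 * #D := by
  have hsub : T ⊆ D.biUnion fun e => e.toFinset := by
    intro v hv
    have := h v hv
    by_contra hc
    apply this
    apply sum_eq_zero
    intro e he
    simp only [mem_biUnion, Sym2.mem_toFinset, not_exists, not_and] at hc
    simp [hc e he]
  calc #T ≤ _ := card_le_card hsub
    _ ≤ #D * 2 := card_biUnion_le_card_mul _ _ _ fun e _ => by
        rw [Sym2.card_toFinset]; split_ifs <;> omega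
    _ = 2 * #D := mul_comm _ _

lemma Linked.lt_card_of_separated {G : SimpleGraph V} [DecidableRel G.Adj] {m : ℕ}
    (h1 : Linked G m m) (J : Finset (Sym2 V)) {A B : Finset V} (hd : Disjoint A B)
    (hA : m ≤ #A) (hsep : ∀ a ∈ A, ∀ b ∈ B, G.Adj a b → s(a, b) ∈ J) : #B < m + #J + 1 := by
  classical
  set B' := {b ∈ B | ∃ a ∈ A, G.Adj a b} with hB'
  have hsmall : #(B \ B') < m + 1 := by
    by_contra! hc
    obtain ⟨x, hx, y, hy, hxy⟩ := h1.exists_adj (disjoint_of_subset_right sdiff_subset hd) hA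
      (show m ≤ #(B \ B') by omega)
    simp only [hB', mem_sdiff, mem_filter, not_and, not_exists] at hy
    exact hy.2 hy.1 x hx hxy
  have hB'J : #B' ≤ #J := by
    have hex : ∀ b ∈ B', ∃ a ∈ A, G.Adj a b := fun b hb => (mem_filter.1 hb).2
    choose! f hf hf' using hex
    refine card_le_card_of_injOn (fun b => s(f b, b))
      (fun b hb => hsep _ (hf b hb) _ (mem_filter.1 hb).1 (hf' b hb)) ?_
    intro b hb b' hb' heq
    rcases Sym2.eq_iff.1 heq with h | h
    · exact h.2
    · exfalso
      refine disjoint_left.1 hd (hf b hb) ?_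
      rw [h.1]
      exact (mem_filter.1 hb').1
  have := card_sdiff_add_card_eq_card (filter_subset (fun b => ∃ a ∈ A, G.Adj a b) B)
  rw [← hB'] at this
  omega

variable [Fintype V]

lemma Linked.le_degree {G : SimpleGraph V} [DecidableRel G.Adj] {d : ℕ}
    (h : Linked G 1 (Fintype.card V - d)) (hd : d ≤ Fintype.card V) (v : V) :
    d ≤ G.degree v := by
  by_contra! hlt
  rw [← G.card_neighborFinset_eq_degree] at hlt
  obtain ⟨x, hx, y, hy, hxy⟩ := h.exists_adj (A := {v})
    (B := (insert v (G.neighborFinset v))ᶜ) (by simp) (by simp) (by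
      rw [card_compl]
      have := card_insert_le v (G.neighborFinset v)
      omega)
  rw [mem_singleton] at hx
  subst hx
  simp [hxy] at hy

lemma exists_path {H : SimpleGraph V} [DecidableRel H.Adj] {m : ℕ} (h1 : Linked H m m)
    (hdeg : ∀ v, m ≤ H.degree v) (u v : V) :
    ∃ P ⊆ H.edgeFinset, #P ≤ 3 ∧
      ∀ w, bd P w = (if w = u then 1 else 0) + if w = v then 1 else 0 := by
  by_cases hd : Disjoint (H.neighborFinset u) (H.neighborFinset v)
  · obtain ⟨a, ha, b, hb, hab⟩ := h1.exists_adj hd (by simpa using hdeg u) (by simpa using hdeg v)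
    rw [SimpleGraph.mem_neighborFinset] at ha hb
    refine ⟨symmDiff (symmDiff {s(u, a)} {s(a, b)}) {s(v, b)}, ?_, ?_, ?_⟩
    · refine symmDiff_subset_of_subset (symmDiff_subset_of_subset ?_ ?_) ?_ <;>
        simpa using by assumption
    · refine (card_symmDiff_le _ _).trans ?_
      have := card_symmDiff_le {s(u, a)} {s(a, b)}
      simp only [card_singleton] at this ⊢
      omega
    · intro w
      rw [bd_symmDiff, bd_symmDiff, bd_singleton ha.ne, bd_singleton hab.ne, bd_singleton hb.ne]
      linear_combination CharTwo.add_self_eq_zero (if w = a then (1 : ZMod 2) else 0) +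
        CharTwo.add_self_eq_zero (if w = b then (1 : ZMod 2) else 0)
  · obtain ⟨a, ha, hb⟩ := not_disjoint_iff.1 hd
    rw [SimpleGraph.mem_neighborFinset] at ha hb
    refine ⟨symmDiff {s(u, a)} {s(v, a)}, ?_, ?_, ?_⟩
    · refine symmDiff_subset_of_subset ?_ ?_ <;> simpa using by assumption
    · refine (card_symmDiff_le _ _).trans ?_
      simp
    · intro w
      rw [bd_symmDiff, bd_singleton ha.ne, bd_singleton hb.ne]
      linear_combination CharTwo.add_self_eq_zero (if w = a then (1 : ZMod 2) else 0)

lemma exists_join_of_paths {H : SimpleGraph V} [DecidableRel H.Adj] {m : ℕ} (h1 : Linked H m m)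
    (hdeg : ∀ v, m ≤ H.degree v) (k : ℕ) : ∀ U : Finset V, #U = 2 * k →
    ∃ P ⊆ H.edgeFinset, #P ≤ 3 * k ∧ ∀ w, bd P w = if w ∈ U then 1 else 0 := by
  induction k with
  | zero =>
    intro U hU
    have : U = ∅ := by simpa using hU
    subst this
    exact ⟨∅, by simp, by simp, by simp [bd]⟩
  | succ k ih =>
    intro U hU
    obtain ⟨u, hu⟩ : U.Nonempty := card_pos.1 (by omega)
    have c1 := card_erase_of_mem hu
    obtain ⟨v, hv⟩ : (U.erase u).Nonempty := card_pos.1 (by omega)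
    have c2 := card_erase_of_mem hv
    obtain ⟨P, hP, hPc, hPb⟩ := ih ((U.erase u).erase v) (by omega)
    obtain ⟨Q, hQ, hQc, hQb⟩ := exists_path h1 hdeg u v
    refine ⟨symmDiff P Q, symmDiff_subset_of_subset hP hQ,
      (card_symmDiff_le _ _).trans (by omega), fun w => ?_⟩
    rw [bd_symmDiff, hPb, hQb]
    have hvu := (mem_erase.1 hv).1
    have hvU := (mem_erase.1 hv).2
    by_cases h1 : w = u
    · subst h1; simp [hu, hvu.symm]
    · by_cases h2 : w = v
      · subst h2; simp [hvU, hvu]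
      · simp [h1, h2]

lemma exists_matching {H : SimpleGraph V} [DecidableRel H.Adj] {m : ℕ} (h1 : Linked H m m)
    (k : ℕ) : ∀ T : Finset V, #T = k →
    ∃ M ⊆ H.edgeFinset, ∃ U ⊆ T, #U < 2 * m + 1 ∧ 2 * #M + #U = #T ∧
      (∀ w, bd M w = if w ∈ T \ U then 1 else 0) ∧
      ∀ w, #{e ∈ M | w ∈ e} ≤ if w ∈ T then 1 else 0 := by
  induction k using Nat.strong_induction_on with
  | _ k ih =>
  intro T hT
  by_cases hm : #T < 2 * m + 1
  · exact ⟨∅, by simp, T, subset_rfl, hm, by simp, by simp [bd], by simp⟩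
  obtain ⟨A, hA, hAc⟩ := exists_subset_card_eq (s := T) (n := m) (by omega)
  have hsd := card_sdiff_add_card_eq_card hA
  obtain ⟨x, hx, y, hy, hxy⟩ := h1.exists_adj (A := A) (B := T \ A) disjoint_sdiff
    (by omega) (by omega)
  have hxT := hA hx
  have hyT : y ∈ T := (mem_sdiff.1 hy).1
  have hyx : y ∈ T.erase x := mem_erase.2 ⟨hxy.ne', hyT⟩
  have c1 := card_erase_of_mem hxT
  have c2 := card_erase_of_mem hyx
  have c3 : 0 < #T := card_pos.2 ⟨x, hxT⟩
  have c4 : 0 < #(T.erase x) := card_pos.2 ⟨y, hyx⟩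
  obtain ⟨M, hM, U, hU, hUm, hMU, hMb, hMd⟩ := ih _ (by omega) ((T.erase x).erase y) rfl
  have hnot : s(x, y) ∉ M := by
    intro hmem
    have := hMd x
    rw [if_neg (by simp)] at this
    have h0 := card_eq_zero.1 (Nat.le_zero.1 this)
    have : s(x, y) ∈ ({e ∈ M | x ∈ e} : Finset _) := by simp [hmem]
    rw [h0] at this
    simp at this
  have hUx : x ∉ U := fun h => by simpa using hU h
  have hUy : y ∉ U := fun h => by simpa using hU h
  refine ⟨insert s(x, y) M, ?_, U, hU.trans ((erase_subset _ _).trans (erase_subset _ _)), hUm,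
    ?_, ?_, ?_⟩
  · intro e he
    rcases mem_insert.1 he with rfl | h
    · simpa using hxy
    · exact hM h
  · rw [card_insert_of_notMem hnot]; omega
  · intro w
    have : bd (insert s(x, y) M) w = bd {s(x, y)} w + bd M w := by
      simp only [bd, sum_insert hnot, sum_singleton]
    rw [this, bd_singleton hxy.ne, hMb]
    by_cases hwx : w = x
    · subst hwx; simp [hxy.ne, hxT, hUx]
    · by_cases hwy : w = y
      · subst hwy; simp [hwx, hyT, hUy]
      · simp [hwx, hwy]
  · intro w
    have hw := hMd w
    rw [filter_insert]
    by_cases hwx : w = x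
    · subst hwx
      simp only [mem_erase, ne_eq, not_true_eq_false, false_and, and_false, if_false] at hw
      rw [if_pos (by simp), if_pos hxT]
      exact (card_insert_le _ _).trans (by omega)
    · by_cases hwy : w = y
      · subst hwy
        simp only [mem_erase, ne_eq, not_true_eq_false, false_and, if_false] at hw
        rw [if_pos (by simp), if_pos hyT]
        exact (card_insert_le _ _).trans (by omega)
      · rw [if_neg (by simp [hwx, hwy])]
        simpa [hwx, hwy] using hw

lemma exists_join {H : SimpleGraph V} [DecidableRel H.Adj] {m : ℕ} (h1 : Linked H m m)
    (hdeg : ∀ v, m ≤ H.degree v) (T : Finset V) (hT : Even #T) :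
    ∃ J ⊆ H.edgeFinset, (∀ v, bd J v = if v ∈ T then 1 else 0) ∧ 2 * #J ≤ #T + 6 * m ∧
      ∀ v, #{e ∈ J | v ∈ e} ≤ 1 + 3 * m := by
  obtain ⟨M, hM, U, hU, hUm, hMU, hMb, hMd⟩ := exists_matching h1 _ T rfl
  obtain ⟨t, ht⟩ := hT
  obtain ⟨P, hP, hPc, hPb⟩ := exists_join_of_paths h1 hdeg (t - #M) U (by omega)
  refine ⟨symmDiff M P, symmDiff_subset_of_subset hM hP, fun v => ?_, ?_, fun v => ?_⟩
  · rw [bd_symmDiff, hMb, hPb]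
    by_cases hv : v ∈ U
    · simp [hv, hU hv]
    · simp [hv]
  · have := card_symmDiff_le M P
    omega
  · have h2 := card_filter_symmDiff_le M P (fun e => v ∈ e)
    have h3 := hMd v
    have h4 := card_filter_le P (fun e => v ∈ e)
    have h5 : (if v ∈ T then 1 else 0) ≤ 1 := by split_ifs <;> simp
    omega

lemma card_filter_edgeFinset_eq_degree (G : SimpleGraph V) [DecidableRel G.Adj] (v : V) :
    #{e ∈ G.edgeFinset | v ∈ e} = G.degree v := by
  rw [← G.incidenceFinset_eq_filter v, G.card_incidenceFinset_eq_degree]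

lemma degN_cast (G : SimpleGraph V) [DecidableRel G.Adj] (v : V) :
    (degN G v : ZMod 2) = bd G.edgeFinset v := by
  rw [degN_eq_degree, bd_eq_card, card_filter_edgeFinset_eq_degree]

lemma reachable_of_linked {G K : SimpleGraph V} [DecidableRel G.Adj] [DecidableRel K.Adj] {m : ℕ}
    (h1 : Linked G m m) {J : Finset (Sym2 V)} (hGK : ∀ a b, G.Adj a b → K.Adj a b ∨ s(a, b) ∈ J)
    (hdeg : ∀ v, m ≤ K.degree v) (hJ : 2 * #J + 2 * m + 2 < Fintype.card V) (u v : V) :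
    K.Reachable u v := by
  classical
  by_contra huv
  set S : Finset V := {w | K.Reachable u w} with hS
  have hSu : m ≤ #S := by
    refine (hdeg u).trans ?_
    rw [← K.card_neighborFinset_eq_degree]
    refine card_le_card fun w hw => ?_
    rw [SimpleGraph.mem_neighborFinset] at hw
    simpa [hS] using hw.reachable
  have hSv : m ≤ #Sᶜ := by
    refine (hdeg v).trans ?_
    rw [← K.card_neighborFinset_eq_degree]
    refine card_le_card fun w hw => ?_
    rw [SimpleGraph.mem_neighborFinset] at hw
    simp only [hS, mem_compl, mem_filter, mem_univ, true_and]
    exact fun h => huv (h.trans hw.symm.reachable)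
  have hsep : ∀ a ∈ S, ∀ b ∈ Sᶜ, G.Adj a b → s(a, b) ∈ J := by
    intro a ha b hb hab
    refine (hGK a b hab).resolve_left fun hK => ?_
    simp only [hS, mem_compl, mem_filter, mem_univ, true_and] at ha hb
    exact hb (ha.trans hK.reachable)
  have e1 := h1.lt_card_of_separated J disjoint_compl_right hSu hsep
  have e2 := h1.lt_card_of_separated J (disjoint_compl_left (a := S)) hSv
    (fun a ha b hb hab => by rw [Sym2.eq_swap]; exact hsep b hb a ha hab.symm)
  have := card_add_card_compl S
  omega

lemma card_odd_le_of_isEulerian {G H : SimpleGraph V} [DecidableRel G.Adj] [DecidableRel H.Adj]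
    (hH : IsEulerian H) (T : Finset V) (hT : ∀ v, v ∈ T ↔ Odd (degN G v)) :
    #T ≤ 2 * #(symmDiff G.edgeFinset H.edgeFinset) := by
  refine card_le_two_mul_card_of_bd _ _ fun v hv => ?_
  rw [bd_symmDiff, ← degN_cast, ← degN_cast, ZMod.natCast_eq_one_iff_odd.2 ((hT v).1 hv),
    ZMod.natCast_eq_zero_iff_even.2 (hH.2.1 v)]
  decide

lemma isEulerian_of_join {G K : SimpleGraph V} [DecidableRel G.Adj] [DecidableRel K.Adj]
    {J : Finset (Sym2 V)} (hK : K.edgeFinset = symmDiff G.edgeFinset J)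
    (hJ : ∀ v, bd J v = if Odd (degN G v) then 1 else 0)
    (hreach : ∀ u v, K.Reachable u v) (hV : 1 < Fintype.card V) : IsEulerian K := by
  have : Nontrivial V := Fintype.one_lt_card_iff_nontrivial.1 hV
  have hconn : K.Connected := ⟨hreach⟩
  refine ⟨hconn, fun v => ?_, ?_⟩
  · rw [← ZMod.natCast_eq_zero_iff_even, degN_cast, hK, bd_symmDiff, ← degN_cast, hJ]
    by_cases h : Odd (degN G v)
    · rw [if_pos h, ZMod.natCast_eq_one_iff_odd.2 h]; decide
    · rw [if_neg h, ZMod.natCast_eq_zero_iff_even.2 (Nat.not_odd_iff_even.1 h), add_zero]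
  · obtain ⟨v⟩ := hconn.nonempty
    obtain ⟨w, hw⟩ := hconn.preconnected.exists_adj_of_nontrivial v
    exact ⟨s(v, w), hw⟩

lemma natCard_edgeSet_diff (G H : SimpleGraph V) [DecidableRel G.Adj] [DecidableRel H.Adj] :
    Nat.card ↥(H.edgeSet \ G.edgeSet) = #(H.edgeFinset \ G.edgeFinset) := by
  rw [Nat.card_coe_set_eq, ← Set.ncard_coe_finset]
  simp

/-- Adding a small `T`-join of the complement makes the graph Eulerian. -/
lemma two_mul_Next_mem {G : SimpleGraph V} [DecidableRel G.Adj] {m : ℕ} (hG : Linked G m m)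
    (hGc : Linked Gᶜ m m) (hdG : ∀ v, m ≤ G.degree v) (hdGc : ∀ v, m ≤ Gᶜ.degree v)
    (T : Finset V) (hT : ∀ v, v ∈ T ↔ Odd (degN G v)) (hcard : 2 * m + 2 < Fintype.card V) :
    #T ≤ 2 * Next G ∧ 2 * Next G ≤ #T + 6 * m := by
  classical
  obtain ⟨J, hJ, hJb, hJc, -⟩ := exists_join hGc hdGc T (even_card_odd_degN T hT)
  have hdisj : Disjoint G.edgeFinset J :=
    disjoint_of_subset_right hJ (SimpleGraph.disjoint_edgeFinset.2 disjoint_compl_right)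
  have hsymm : symmDiff G.edgeFinset J = G.edgeFinset ∪ J := by
    rw [hdisj.symmDiff_eq_sup, sup_eq_union]
  obtain ⟨K, hKdef⟩ : ∃ K : SimpleGraph V,
      K = SimpleGraph.fromEdgeSet (G.edgeFinset ∪ J : Finset (Sym2 V)) := ⟨_, rfl⟩
  have hKe : K.edgeFinset = symmDiff G.edgeFinset J := by
    rw [hsymm]
    ext e
    simp only [SimpleGraph.mem_edgeFinset, hKdef, SimpleGraph.edgeSet_fromEdgeSet, Set.mem_sdiff,
      mem_coe, mem_union, Sym2.mem_diagSet]
    refine ⟨fun h => h.1, fun h => ⟨h, ?_⟩⟩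
    rcases h with h | h
    · exact G.not_isDiag_of_mem_edgeSet h
    · exact Gᶜ.not_isDiag_of_mem_edgeSet (SimpleGraph.mem_edgeFinset.1 (hJ h))
  have hGK : G ≤ K := by
    rw [← SimpleGraph.edgeFinset_subset_edgeFinset, hKe, hsymm]
    exact subset_union_left
  have hKE : IsEulerian K := isEulerian_of_join hKe (fun v => by simp [hJb, hT])
    (fun u v => (reachable_of_linked hG (J := ∅) (fun a b h => Or.inl h) hdG
      (by simpa using hcard) u v).mono hGK) (by omega)
  have hmem : #J ∈ {k | ∃ H : SimpleGraph V, IsEulerian H ∧ G ≤ H ∧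
      Nat.card ↥(H.edgeSet \ G.edgeSet) = k} := by
    refine ⟨K, hKE, hGK, ?_⟩
    rw [natCard_edgeSet_diff, hKe, hsymm, union_sdiff_left, sdiff_eq_self_of_disjoint hdisj.symm]
  constructor
  · obtain ⟨H, hH, hGH, hc⟩ := Nat.sInf_mem ⟨_, hmem⟩
    have := card_odd_le_of_isEulerian hH T hT
    rw [symmDiff_of_le (SimpleGraph.edgeFinset_mono hGH), ← natCard_edgeSet_diff, hc] at this
    exact this
  · have : Next G ≤ #J := Nat.sInf_le hmem
    omega

/-- Removing a small `T`-join makes the graph Eulerian. -/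
lemma two_mul_Nred_mem {G : SimpleGraph V} [DecidableRel G.Adj] {m : ℕ} (hG : Linked G m m)
    (hdG : ∀ v, 4 * m + 1 ≤ G.degree v)
    (T : Finset V) (hT : ∀ v, v ∈ T ↔ Odd (degN G v)) (hcard : #T + 8 * m + 2 < Fintype.card V) :
    #T ≤ 2 * Nred G ∧ 2 * Nred G ≤ #T + 6 * m := by
  classical
  obtain ⟨J, hJ, hJb, hJc, hJd⟩ := exists_join hG
    (fun v => le_trans (by omega) (hdG v)) T (even_card_odd_degN T hT)
  have hsymm : symmDiff G.edgeFinset J = G.edgeFinset \ J := symmDiff_of_ge hJ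
  obtain ⟨K, hKdef⟩ : ∃ K : SimpleGraph V,
      K = SimpleGraph.fromEdgeSet (G.edgeFinset \ J : Finset (Sym2 V)) := ⟨_, rfl⟩
  have hKe : K.edgeFinset = symmDiff G.edgeFinset J := by
    rw [hsymm]
    ext e
    simp only [SimpleGraph.mem_edgeFinset, hKdef, SimpleGraph.edgeSet_fromEdgeSet, Set.mem_sdiff,
      mem_coe, mem_sdiff, Sym2.mem_diagSet]
    exact ⟨fun h => h.1, fun h => ⟨h, G.not_isDiag_of_mem_edgeSet h.1⟩⟩
  have hKG : K ≤ G := by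
    rw [← SimpleGraph.edgeFinset_subset_edgeFinset, hKe, hsymm]
    exact sdiff_subset
  have hadj : ∀ a b, G.Adj a b → K.Adj a b ∨ s(a, b) ∈ J := by
    intro a b hab
    by_cases h : s(a, b) ∈ J
    · exact Or.inr h
    · left
      rw [← SimpleGraph.mem_edgeSet, ← SimpleGraph.mem_edgeFinset, hKe, hsymm, mem_sdiff]
      exact ⟨by simpa using hab, h⟩
  have hdK : ∀ v, m ≤ K.degree v := by
    intro v
    have h1 := card_filter_edgeFinset_eq_degree K v
    have h2 := card_filter_edgeFinset_eq_degree G v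
    rw [hKe, hsymm] at h1
    have h3 : #{e ∈ G.edgeFinset | v ∈ e} ≤
        #{e ∈ G.edgeFinset \ J | v ∈ e} + #{e ∈ J | v ∈ e} := by
      refine (card_le_card fun e he => ?_).trans (card_union_le _ _)
      simp only [mem_filter, mem_union, mem_sdiff] at he ⊢
      tauto
    have h4 := hdG v
    have h5 := hJd v
    omega
  have hKE : IsEulerian K := isEulerian_of_join hKe (fun v => by simp [hJb, hT])
    (reachable_of_linked hG hadj hdK (by omega)) (by omega)
  have hmem : #J ∈ {k | ∃ H : SimpleGraph V, IsEulerian H ∧ H ≤ G ∧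
      Nat.card ↥(G.edgeSet \ H.edgeSet) = k} := by
    refine ⟨K, hKE, hKG, ?_⟩
    rw [natCard_edgeSet_diff, hKe, hsymm, Finset.sdiff_sdiff_eq_self hJ]
  constructor
  · obtain ⟨H, hH, hGH, hc⟩ := Nat.sInf_mem ⟨_, hmem⟩
    have := card_odd_le_of_isEulerian hH T hT
    rw [symmDiff_of_ge (SimpleGraph.edgeFinset_mono hGH), ← natCard_edgeSet_diff, hc] at this
    exact this
  · have : Nred G ≤ #J := Nat.sInf_le hmem
    omega

end Deterministic

section Probability

open Finset

lemma isProbabilityMeasure_bern {p : ℝ} (h0 : 0 ≤ p) (h1 : p ≤ 1) :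
    IsProbabilityMeasure (bern p) := by
  constructor
  simp only [bern, Measure.add_apply, Measure.smul_apply, measure_univ]
  rw [ENNReal.smul_def, ENNReal.smul_def, smul_eq_mul, smul_eq_mul, mul_one, mul_one,
    ← ENNReal.coe_add, ← Real.toNNReal_add h0 (by linarith)]
  simp

lemma isProbabilityMeasure_erMeasure {n : ℕ} {p : ℝ} (h0 : 0 ≤ p) (h1 : p ≤ 1) :
    IsProbabilityMeasure (erMeasure n p) := by
  have := isProbabilityMeasure_bern h0 h1
  unfold erMeasure
  infer_instance

instance (n : ℕ) (p : ℝ) : IsFiniteMeasure (erMeasure n p) := by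
  unfold erMeasure
  infer_instance

lemma bern_real_singleton {p : ℝ} (h0 : 0 ≤ p) (h1 : p ≤ 1) (c : Bool) :
    (bern p).real {c} = if c then p else 1 - p := by
  have h2 : 0 ≤ 1 - p := by linarith
  rw [Measure.real, bern, Measure.add_apply, Measure.smul_apply, Measure.smul_apply,
    ENNReal.smul_def, ENNReal.smul_def]
  cases c <;> simp [h0, h1]

lemma integral_bern {p : ℝ} (h0 : 0 ≤ p) (h1 : p ≤ 1) (f : Bool → ℝ) :
    ∫ b, f b ∂bern p = p * f true + (1 - p) * f false := by
  rw [integral_fintype .of_finite]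
  simp [bern_real_singleton h0 h1]

lemma integrable_erMeasure {n : ℕ} (p : ℝ) (f : (Sym2 (Fin n) → Bool) → ℝ) :
    Integrable f (erMeasure n p) := .of_finite

lemma erMeasure_real_forall_eq {n : ℕ} (p : ℝ) (c : Bool) (h0 : 0 ≤ p) (h1 : p ≤ 1)
    {A B : Finset (Fin n)} (hd : Disjoint A B) :
    (erMeasure n p).real {ω | ∀ a ∈ A, ∀ b ∈ B, ω s(a, b) = c} =
      (bern p).real {c} ^ (#A * #B) := by
  have := isProbabilityMeasure_bern h0 h1
  set I : Finset (Sym2 (Fin n)) := (A ×ˢ B).image fun x => s(x.1, x.2) with hI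
  have hset : {ω : Sym2 (Fin n) → Bool | ∀ a ∈ A, ∀ b ∈ B, ω s(a, b) = c} =
      Set.univ.pi fun e => if e ∈ I then {c} else Set.univ := by
    ext ω
    simp only [Set.mem_ofPred_eq, Set.mem_pi, Set.mem_univ, true_implies]
    constructor
    · intro h e
      split_ifs with he
      · obtain ⟨⟨a, b⟩, hab, rfl⟩ := mem_image.1 he
        rw [mem_product] at hab
        exact h a hab.1 b hab.2
      · trivial
    · intro h a ha b hb
      have := h s(a, b)
      rwa [if_pos (mem_image.2 ⟨(a, b), mem_product.2 ⟨ha, hb⟩, rfl⟩)] at this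
  have hcard : #I = #A * #B := by
    rw [hI, card_image_of_injOn, card_product]
    rintro ⟨a, b⟩ hab ⟨a', b'⟩ hab' heq
    simp only [coe_product, Set.mem_prod, mem_coe] at hab hab'
    rcases Sym2.eq_iff.1 heq with h | h
    · exact Prod.ext h.1 h.2
    · exact (disjoint_left.1 hd hab.1 (by have := h.1; simp only at this; rw [this]; exact hab'.2)).elim
  rw [hset, Measure.real, erMeasure, Measure.pi_pi, ENNReal.toReal_prod, ← hcard]
  simp only [apply_ite, measure_univ, ENNReal.toReal_one]
  rw [prod_ite]
  simp [Measure.real]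

/-- The graph of the edges in state `c`. -/
def colorGraph (n : ℕ) (c : Bool) (ω : Sym2 (Fin n) → Bool) : SimpleGraph (Fin n) :=
  SimpleGraph.fromEdgeSet {e | ω e = c}

lemma colorGraph_false (n : ℕ) (ω : Sym2 (Fin n) → Bool) :
    colorGraph n false ω = (erGraph n ω)ᶜ := by
  ext a b
  by_cases h : a = b <;> simp [colorGraph, erGraph, h]

lemma erMeasure_real_not_linked_le {n : ℕ} {p q : ℝ} (h0 : 0 ≤ q) (h1 : q ≤ p) (h2 : p ≤ 1 - q)
    (c : Bool) (a b : ℕ) :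
    (erMeasure n p).real {ω | ¬ Linked (colorGraph n c ω) a b} ≤
      n.choose a * n.choose b * Real.exp (-q * (a * b)) := by
  set F : Finset (Finset (Fin n) × Finset (Fin n)) :=
    {x ∈ powersetCard a univ ×ˢ powersetCard b univ | Disjoint x.1 x.2} with hF
  have hsub : {ω | ¬ Linked (colorGraph n c ω) a b} ⊆
      ⋃ x ∈ F, {ω | ∀ i ∈ x.1, ∀ j ∈ x.2, ω s(i, j) = !c} := by
    intro ω hω
    simp only [Linked, Set.mem_ofPred_eq, not_forall] at hω
    obtain ⟨A, B, hd, hA, hB, hn⟩ := hω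
    simp only [Set.mem_iUnion]
    refine ⟨(A, B), by simp [hF, hd, hA, hB], fun i hi j hj => ?_⟩
    by_contra hc
    refine hn ⟨i, hi, j, hj, ?_⟩
    simp only [colorGraph, SimpleGraph.fromEdgeSet_adj, Set.mem_ofPred_eq]
    refine ⟨by simpa using hc, ?_⟩
    rintro rfl
    exact disjoint_left.1 hd hi hj
  have hbern : (bern p).real {!c} ≤ Real.exp (-q) := by
    rw [bern_real_singleton (by linarith) (by linarith)]
    have := Real.add_one_le_exp (-q)
    split_ifs <;> linarith
  calc (erMeasure n p).real {ω | ¬ Linked (colorGraph n c ω) a b}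
      ≤ _ := measureReal_mono hsub (measure_ne_top _ _)
    _ ≤ _ := measureReal_biUnion_finset_le _ _
    _ ≤ ∑ x ∈ F, Real.exp (-q * (a * b)) := by
        refine sum_le_sum fun x hx => ?_
        simp only [hF, mem_filter, mem_product, mem_powersetCard] at hx
        rw [erMeasure_real_forall_eq p _ (by linarith) (by linarith) hx.2, hx.1.1.2, hx.1.2.2]
        refine (pow_le_pow_left₀ measureReal_nonneg hbern _).trans_eq ?_
        rw [← Real.exp_nat_mul]
        push_cast
        ring_nf
    _ ≤ _ := by
        rw [sum_const, nsmul_eq_mul]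
        gcongr
        have : #F ≤ n.choose a * n.choose b := by
          refine (card_filter_le _ _).trans ?_
          simp
        exact_mod_cast this

/-- The sign of a Boolean. -/
def bsign (b : Bool) : ℝ := if b then -1 else 1

/-- The contribution of an edge in state `b` to the degree sign at `v`. -/
def edgeSign {n : ℕ} (v : Fin n) (e : Sym2 (Fin n)) (b : Bool) : ℝ :=
  if v ∈ e ∧ ¬ e.IsDiag then bsign b else 1

/-- The sign `(-1) ^ deg v`. -/
noncomputable def degSign {n : ℕ} (v : Fin n) (ω : Sym2 (Fin n) → Bool) : ℝ :=
  ∏ e, edgeSign v e (ω e)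

lemma degSign_eq {n : ℕ} (v : Fin n) (ω : Sym2 (Fin n) → Bool) :
    degSign v ω = (-1) ^ degN (erGraph n ω) v := by
  classical
  rw [degN_eq_degree, ← card_filter_edgeFinset_eq_degree, degSign]
  have : ∀ e, edgeSign v e (ω e) =
      if e ∈ ({e ∈ (erGraph n ω).edgeFinset | v ∈ e} : Finset _) then -1 else 1 := by
    intro e
    have hmem : e ∈ (erGraph n ω).edgeFinset ↔ ω e = true ∧ ¬ e.IsDiag := by
      rw [SimpleGraph.mem_edgeFinset]
      simp [erGraph]
    simp only [edgeSign, bsign, mem_filter, hmem]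
    by_cases h1 : v ∈ e <;> by_cases h2 : e.IsDiag <;> by_cases h3 : ω e = true <;>
      simp [h1, h2, h3]
  simp_rw [this]
  rw [prod_ite, prod_const_one, mul_one, prod_const, filter_mem_eq_inter, univ_inter]

lemma degSign_sq {n : ℕ} (v : Fin n) (ω : Sym2 (Fin n) → Bool) :
    degSign v ω = 1 ∨ degSign v ω = -1 := by
  rw [degSign_eq]
  exact neg_one_pow_eq_or ℝ _

lemma sum_degSign {n : ℕ} (ω : Sym2 (Fin n) → Bool) (T : Finset (Fin n))
    (hT : ∀ v, v ∈ T ↔ Odd (degN (erGraph n ω) v)) :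
    ∑ v, degSign v ω = n - 2 * #T := by
  have : ∀ v, degSign v ω = 1 - 2 * if v ∈ T then 1 else 0 := by
    intro v
    rw [degSign_eq]
    by_cases h : v ∈ T
    · rw [((hT v).1 h).neg_one_pow, if_pos h]; norm_num
    · rw [(Nat.not_odd_iff_even.1 (mt (hT v).2 h)).neg_one_pow, if_neg h]; norm_num
  simp_rw [this]
  rw [sum_sub_distrib, ← mul_sum]
  simp

lemma abs_prod_edgeSign {n : ℕ} (S : Finset (Fin n)) (e : Sym2 (Fin n)) (b : Bool) :
    |∏ v ∈ S, edgeSign v e b| = 1 := by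
  rw [abs_prod]
  refine prod_eq_one fun v _ => ?_
  unfold edgeSign bsign
  split_ifs <;> simp

lemma integral_prod_degSign {n : ℕ} (p : ℝ) (S : Finset (Fin n)) :
    ∫ ω, ∏ v ∈ S, degSign v ω ∂erMeasure n p =
      ∏ e : Sym2 (Fin n), ∫ b, ∏ v ∈ S, edgeSign v e b ∂bern p := by
  rw [erMeasure, ← integral_fintype_prod_eq_prod (𝕜 := ℝ)]
  congr 1
  ext ω
  simp only [degSign]
  exact prod_comm

lemma exists_crossing {n : ℕ} (S : Finset (Fin n)) (h : S.Nonempty) (h' : S ≠ univ) :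
    ∃ C : Finset (Sym2 (Fin n)), n ≤ 2 * #C ∧
      ∀ e ∈ C, ∃ u w, e = s(u, w) ∧ u ∈ S ∧ w ∉ S := by
  have hc := card_add_card_compl S
  rw [Fintype.card_fin] at hc
  obtain ⟨w, hw⟩ : ∃ w, w ∉ S := by
    by_contra! hall
    exact h' (eq_univ_iff_forall.2 hall)
  obtain ⟨u, hu⟩ := h
  by_cases hS : n ≤ 2 * #S
  · refine ⟨S.image fun u => s(u, w), ?_, ?_⟩
    · rw [card_image_of_injective _ fun a b hab => Sym2.congr_left.1 hab]
      exact hS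
    · intro e he
      obtain ⟨u, hu, rfl⟩ := mem_image.1 he
      exact ⟨u, w, rfl, hu, hw⟩
  · refine ⟨Sᶜ.image fun w => s(u, w), ?_, ?_⟩
    · rw [card_image_of_injective _ fun a b hab => Sym2.congr_right.1 hab]
      omega
    · intro e he
      obtain ⟨w, hw, rfl⟩ := mem_image.1 he
      exact ⟨u, w, rfl, hu, mem_compl.1 hw⟩

lemma prod_edgeSign_crossing {n : ℕ} (S : Finset (Fin n)) {u w : Fin n} (hu : u ∈ S) (hw : w ∉ S)
    (b : Bool) : ∏ v ∈ S, edgeSign v s(u, w) b = bsign b := by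
  have huw : u ≠ w := fun h => hw (h ▸ hu)
  rw [prod_eq_single_of_mem u hu]
  · simp [edgeSign, huw]
  · intro v hv hvu
    have : v ≠ w := fun h => hw (h ▸ hv)
    simp [edgeSign, hvu, this]

lemma abs_integral_prod_degSign_le {n : ℕ} {p q : ℝ} (h0 : 0 ≤ q) (h1 : q ≤ p) (h2 : p ≤ 1 - q)
    (S : Finset (Fin n)) :
    |∫ ω, ∏ v ∈ S, degSign v ω ∂erMeasure n p| ≤ 1 ∧
    (S.Nonempty → S ≠ univ →
      |∫ ω, ∏ v ∈ S, degSign v ω ∂erMeasure n p| ≤ Real.exp (-q * n)) := by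
  have hp0 : 0 ≤ p := h0.trans h1
  have hp1 : p ≤ 1 := by linarith
  have hone : ∀ e : Sym2 (Fin n), |∫ b, ∏ v ∈ S, edgeSign v e b ∂bern p| ≤ 1 := by
    intro e
    rw [integral_bern hp0 hp1]
    have a1 := abs_prod_edgeSign S e true
    have a2 := abs_prod_edgeSign S e false
    refine (abs_add_le _ _).trans ?_
    rw [abs_mul, abs_mul, a1, a2, abs_of_nonneg hp0, abs_of_nonneg (by linarith)]
    linarith
  rw [integral_prod_degSign]
  constructor
  · rw [abs_prod]
    exact prod_le_one (fun _ _ => abs_nonneg _) fun e _ => hone e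
  · intro hS hS'
    obtain ⟨C, hC, hCe⟩ := exists_crossing S hS hS'
    have hbd : ∀ e : Sym2 (Fin n), |∫ b, ∏ v ∈ S, edgeSign v e b ∂bern p| ≤
        if e ∈ C then Real.exp (-2 * q) else 1 := by
      intro e
      split_ifs with he
      · obtain ⟨u, w, rfl, hu, hw⟩ := hCe e he
        simp_rw [prod_edgeSign_crossing S hu hw]
        rw [integral_bern hp0 hp1]
        have := Real.add_one_le_exp (-2 * q)
        simp only [bsign]
        refine le_trans ?_ this
        rw [abs_le]
        constructor <;> norm_num <;> linarith
      · exact hone e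
    rw [abs_prod]
    refine (prod_le_prod (fun _ _ => abs_nonneg _) fun e _ => hbd e).trans ?_
    rw [prod_ite]
    simp only [prod_const_one, mul_one, prod_const, filter_mem_eq_inter, univ_inter]
    rw [← Real.exp_nat_mul, Real.exp_le_exp]
    have : (n : ℝ) ≤ 2 * #C := by exact_mod_cast hC
    nlinarith

lemma exp_mul_of_sign (l : ℝ) {x : ℝ} (hx : x = 1 ∨ x = -1) :
    Real.exp (l * x) = x * Real.sinh l + Real.cosh l := by
  rcases hx with rfl | rfl
  · rw [mul_one, one_mul, Real.sinh_add_cosh]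
  · rw [mul_neg_one, ← Real.cosh_sub_sinh]; ring

lemma abs_sinh_add_cosh (l : ℝ) : |Real.sinh l| + Real.cosh l = Real.exp |l| := by
  rw [Real.abs_sinh, ← Real.cosh_abs l, Real.sinh_add_cosh]

lemma integral_exp_sum_degSign_le {n : ℕ} {p q : ℝ} (h0 : 0 ≤ q) (h1 : q ≤ p) (h2 : p ≤ 1 - q)
    (l : ℝ) :
    ∫ ω, Real.exp (l * ∑ v, degSign v ω) ∂erMeasure n p ≤
      2 * Real.exp (n * (l ^ 2 / 2)) + Real.exp (n * |l| - q * n) := by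
  have hexp : ∀ ω : Sym2 (Fin n) → Bool, Real.exp (l * ∑ v, degSign v ω) =
      ∑ S : Finset (Fin n), (Real.sinh l ^ #S * Real.cosh l ^ #Sᶜ) * ∏ v ∈ S, degSign v ω := by
    intro ω
    rw [mul_sum, Real.exp_sum]
    simp_rw [fun v => exp_mul_of_sign l (degSign_sq v ω)]
    rw [Finset.prod_add, powerset_univ]
    refine sum_congr rfl fun S _ => ?_
    rw [prod_mul_distrib, prod_const, prod_const, ← compl_eq_univ_sdiff]
    ring
  simp_rw [hexp]
  rw [integral_finsetSum _ fun _ _ => integrable_erMeasure _ _]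
  simp_rw [integral_const_mul]
  have hc := Real.cosh_pos l
  have hcosh : Real.cosh l ^ n ≤ Real.exp (n * (l ^ 2 / 2)) := by
    rw [Real.exp_nat_mul]
    exact pow_le_pow_left₀ hc.le (Real.cosh_le_exp_half_sq l) n
  have hsc : |Real.sinh l| ≤ Real.cosh l := by
    rw [abs_le]
    have e1 := Real.sinh_add_cosh l
    have e2 := Real.cosh_sub_sinh l
    constructor <;> linarith [Real.exp_pos l, Real.exp_pos (-l)]
  have hsinh : |Real.sinh l| ^ n ≤ Real.exp (n * (l ^ 2 / 2)) :=
    (pow_le_pow_left₀ (abs_nonneg _) hsc n).trans hcosh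
  have hterm : ∀ S : Finset (Fin n), (Real.sinh l ^ #S * Real.cosh l ^ #Sᶜ) *
      ∫ ω, ∏ v ∈ S, degSign v ω ∂erMeasure n p ≤
      (if S = ∅ then Real.cosh l ^ n else 0) + (if S = univ then |Real.sinh l| ^ n else 0) +
      (|Real.sinh l| ^ #S * Real.cosh l ^ #Sᶜ) * Real.exp (-q * n) := by
    intro S
    obtain ⟨b1, b2⟩ := abs_integral_prod_degSign_le (n := n) h0 h1 h2 S
    have hpos : 0 ≤ (|Real.sinh l| ^ #S * Real.cosh l ^ #Sᶜ) * Real.exp (-q * n) := by positivity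
    by_cases hS : S = ∅
    · subst hS
      have hp := isProbabilityMeasure_erMeasure (n := n) (h0.trans h1) (by linarith : p ≤ 1)
      have : 0 ≤ if (∅ : Finset (Fin n)) = univ then |Real.sinh l| ^ n else 0 := by positivity
      simp only [card_empty, pow_zero, one_mul, compl_empty, card_univ, Fintype.card_fin,
        prod_empty, integral_const, probReal_univ, smul_eq_mul, mul_one, if_true] at hpos this ⊢
      linarith
    · by_cases hS' : S = univ
      · have hle : Real.sinh l ^ n * ∫ ω, ∏ v ∈ S, degSign v ω ∂erMeasure n p ≤
            |Real.sinh l| ^ n := by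
          refine (le_abs_self _).trans ?_
          rw [abs_mul, abs_pow]
          exact mul_le_of_le_one_right (by positivity) b1
        subst hS'
        simp only [card_univ, Fintype.card_fin, compl_univ, card_empty, pow_zero, mul_one,
          if_true, if_neg hS, zero_add] at hle hpos ⊢
        linarith
      · rw [if_neg hS, if_neg hS', zero_add, zero_add]
        refine (le_abs_self _).trans ?_
        rw [abs_mul, abs_mul, abs_pow, abs_pow, abs_of_pos hc]
        gcongr
        exact b2 (nonempty_iff_ne_empty.2 hS) hS'
  refine (sum_le_sum fun S _ => hterm S).trans ?_
  rw [sum_add_distrib, sum_add_distrib, ← sum_mul]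
  have hbin : ∑ S : Finset (Fin n), |Real.sinh l| ^ #S * Real.cosh l ^ #Sᶜ = Real.exp (n * |l|) := by
    rw [Real.exp_nat_mul, ← abs_sinh_add_cosh]
    have := Finset.prod_add (fun _ : Fin n => |Real.sinh l|) (fun _ => Real.cosh l) univ
    simp only [prod_const, card_univ, Fintype.card_fin, powerset_univ,
      ← compl_eq_univ_sdiff] at this
    exact this.symm
  rw [hbin, ← Real.exp_add]
  simp only [sum_ite_eq', mem_univ, if_true]
  rw [show (n : ℝ) * |l| + -q * n = n * |l| - q * n by ring]
  linarith

lemma erMeasure_real_sum_degSign_ge_le {n : ℕ} (hn : 0 < n) {p q : ℝ} (h0 : 0 ≤ q) (h1 : q ≤ p)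
    (h2 : p ≤ 1 - q) (hq : √n ≤ q * n) (t : ℝ) {σ : ℝ} (hσ : |σ| = 1) :
    (erMeasure n p).real {ω | t ≤ σ * ∑ v, degSign v ω} ≤ 5 * Real.exp (-(t / √n)) := by
  have hs : 0 < √(n : ℝ) := Real.sqrt_pos.2 (by exact_mod_cast hn)
  have hsq : √(n : ℝ) ^ 2 = n := Real.sq_sqrt (by positivity)
  have hmark := ProbabilityTheory.measure_ge_le_exp_mul_mgf (μ := erMeasure n p)
    (X := fun ω => σ * ∑ v, degSign v ω) t (t := (√n)⁻¹) (by positivity)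
    (integrable_erMeasure _ _)
  refine hmark.trans ?_
  have hmgf : ProbabilityTheory.mgf (fun ω => σ * ∑ v, degSign v ω) (erMeasure n p) (√n)⁻¹ ≤ 5 := by
    have := integral_exp_sum_degSign_le (n := n) h0 h1 h2 ((√n)⁻¹ * σ)
    simp only [ProbabilityTheory.mgf, ← mul_assoc]
    refine this.trans ?_
    have habs : |(√(n : ℝ))⁻¹ * σ| = (√n)⁻¹ := by
      rw [abs_mul, hσ, mul_one, abs_of_pos (by positivity)]
    have e1 : (n : ℝ) * (((√n)⁻¹ * σ) ^ 2 / 2) = 1 / 2 := by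
      rw [← sq_abs, habs, inv_pow, hsq]
      have : (n : ℝ) ≠ 0 := by positivity
      field_simp
    have e2 : (n : ℝ) * (√n)⁻¹ = √n := by
      nth_rewrite 1 [← hsq]
      field_simp
    rw [e1, habs, e2]
    have e3 : Real.exp (√n - q * n) ≤ 1 := Real.exp_le_one_iff.2 (by linarith)
    have e4 : Real.exp (1 / 2) ≤ 2 := by
      have := Real.exp_one_lt_d9
      have h5 : Real.exp (1 / 2) ^ 2 = Real.exp 1 := by
        rw [← Real.exp_nat_mul]; norm_num
      nlinarith [Real.exp_pos (1 / 2)]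
    linarith
  rw [mul_comm]
  refine (mul_le_mul_of_nonneg_right hmgf (Real.exp_pos _).le).trans_eq ?_
  rw [show -(√(n : ℝ))⁻¹ * t = -(t / √n) by ring]

end Probability

section Asymptotics

open Filter

lemma eventually_mul_log_add_le_rpow {K a : ℝ} (hK : 0 < K) (ha : 0 < a) :
    ∀ᶠ n : ℕ in atTop, K * Real.log n + 4 ≤ (n : ℝ) ^ a := by
  refine tendsto_natCast_atTop_atTop.eventually (p := fun x : ℝ => K * Real.log x + 4 ≤ x ^ a) ?_
  have h1 := (isLittleO_log_rpow_atTop ha).bound (show 0 < 1 / (2 * K) by positivity)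
  have h2 := (tendsto_rpow_atTop ha).eventually_ge_atTop 8
  filter_upwards [h1, h2] with x hx hx8
  rw [Real.norm_eq_abs, Real.norm_eq_abs, abs_of_nonneg (by linarith : 0 ≤ x ^ a)] at hx
  have h3 := mul_le_mul_of_nonneg_left ((le_abs_self _).trans hx) hK.le
  have h4 : K * (1 / (2 * K) * x ^ a) = x ^ a / 2 := by field_simp
  linarith

lemma exists_parameter {η r : ℝ} (hη : 0 < η) (hη' : η ≤ 1 / 4) (hr : 0 < r) :
    ∀ᶠ n : ℕ in atTop, 0 < n ∧ ∃ m : ℕ,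
      (n : ℝ) ^ m * (n : ℝ) ^ m * Real.exp (-(Real.log n ^ 2 / √n) * (m * m)) ≤
        1 / (n : ℝ) ^ r / 6 ∧
      (n : ℝ) * (n : ℝ) ^ (4 * m + 1) *
        Real.exp (-(Real.log n ^ 2 / √n) * (n - (4 * m + 1))) ≤ 1 / (n : ℝ) ^ r / 6 ∧
      5 * Real.exp (-((n : ℝ) ^ (1 / 2 + η) / √n)) ≤ 1 / (n : ℝ) ^ r / 6 ∧
      √n ≤ Real.log n ^ 2 / √n * n ∧
      4 * (m : ℝ) ≤ (n : ℝ) ^ (1 / 2 + η) ∧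
      (n : ℝ) / 2 + (n : ℝ) ^ (1 / 2 + η) / 2 + 8 * m + 2 < n := by
  have h1 := eventually_mul_log_add_le_rpow (show 0 < r + 6 by positivity)
    (show (0 : ℝ) < 1 / 2 by norm_num)
  have h2 := eventually_mul_log_add_le_rpow hr hη
  have h3 := ((tendsto_rpow_atTop (show 0 < 1 / 2 - η by linarith)).comp
    tendsto_natCast_atTop_atTop).eventually_ge_atTop (4 : ℝ)
  have h4 := (Real.tendsto_log_atTop.comp tendsto_natCast_atTop_atTop).eventually_ge_atTop (8 : ℝ)
  filter_upwards [h1, h2, h3, h4, eventually_ge_atTop 1] with n h1 h2 h3 h4 hn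
  simp only [Function.comp_apply] at h3 h4
  have hn0 : (0 : ℝ) < n := by exact_mod_cast hn
  rw [← Real.sqrt_eq_rpow] at h1
  have hE : (n : ℝ) ^ (1 / 2 + η) = √n * (n : ℝ) ^ η := by
    rw [Real.rpow_add hn0, ← Real.sqrt_eq_rpow]
  have hs4 : (n : ℝ) ^ η * 4 ≤ √n := by
    have : √(n : ℝ) = (n : ℝ) ^ η * (n : ℝ) ^ (1 / 2 - η) := by
      rw [← Real.rpow_add hn0, Real.sqrt_eq_rpow]; ring_nf
    rw [this]
    gcongr
  have hnL : (n : ℝ) = Real.exp (Real.log n) := (Real.exp_log hn0).symm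
  have hnr : 1 / (n : ℝ) ^ r = Real.exp (-(r * Real.log n)) := by
    rw [Real.rpow_def_of_pos hn0, one_div, ← Real.exp_neg]; ring_nf
  have hpow : ∀ k : ℕ, (n : ℝ) ^ k = Real.exp (k * Real.log n) := by
    intro k; rw [Real.exp_nat_mul, ← hnL]
  have hss : √(n : ℝ) * √n = n := Real.mul_self_sqrt hn0.le
  rw [hE, hnr]
  set L := Real.log n with hL
  set s := √(n : ℝ) with hs
  set w := (n : ℝ) ^ η with hw
  have hrL : 0 < r * L := by positivity
  have hs20 : 48 ≤ s := by linarith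
  have hs0 : 0 < s := by linarith
  have e2 : 6 ≤ Real.exp 2 := by
    have := Real.exp_one_gt_d9
    rw [show (2 : ℝ) = 1 + 1 by norm_num, Real.exp_add]; nlinarith
  have e4 : 30 ≤ Real.exp 4 := by
    rw [show (4 : ℝ) = 2 + 2 by norm_num, Real.exp_add]; nlinarith
  have hsix : ∀ y, y ≤ -(r * L) - 2 → Real.exp y ≤ Real.exp (-(r * L)) / 6 := by
    intro y hy
    rw [le_div_iff₀ (by norm_num)]
    calc Real.exp y * 6 ≤ Real.exp y * Real.exp 2 := by gcongr
      _ = Real.exp (y + 2) := (Real.exp_add _ _).symm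
      _ ≤ _ := Real.exp_le_exp.2 (by linarith)
  have hm1 : 4 * s / L ≤ ⌈4 * s / L⌉₊ := Nat.le_ceil _
  have hm2 : (⌈4 * s / L⌉₊ : ℝ) < 4 * s / L + 1 := Nat.ceil_lt_add_one (by positivity)
  refine ⟨hn, ⌈4 * s / L⌉₊, ?_⟩
  generalize (⌈4 * s / L⌉₊) = m at hm1 hm2
  have hmL : 4 * s ≤ m * L := by rwa [div_le_iff₀ (by linarith)] at hm1
  have hmL2 : m * L ≤ 4 * s + L := by
    have : 4 * s / L * L = 4 * s := div_mul_cancel₀ _ (by linarith)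
    nlinarith
  have hms : 2 * (m : ℝ) ≤ s + 2 := by nlinarith
  have hqs : L ^ 2 / s * s = L ^ 2 := div_mul_cancel₀ _ hs0.ne'
  have hqm : 4 * L ≤ L ^ 2 / s * m := by
    rw [div_mul_eq_mul_div, le_div_iff₀ hs0]; nlinarith
  have hqn : L ^ 2 / s * n = L ^ 2 * s := by rw [← hss, ← mul_assoc, hqs]
  have hw0 : 0 < w := by linarith
  have hL2 : 64 ≤ L ^ 2 := by
    have := mul_self_le_mul_self (by norm_num) h4
    linarith [sq L]
  have h8 : 64 * s ≤ L ^ 2 * s := mul_le_mul_of_nonneg_right hL2 hs0.le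
  have hns : 48 * s ≤ n := (mul_le_mul_of_nonneg_right hs20 hs0.le).trans_eq hss
  have hsw : 4 * s ≤ s * w := by
    rw [mul_comm s w]
    exact mul_le_mul_of_nonneg_right (by linarith) hs0.le
  have hsw2 : s * w * 4 ≤ n := by
    rw [← hss, mul_assoc]
    exact mul_le_mul_of_nonneg_left hs4 hs0.le
  refine ⟨?_, ?_, ?_, ?_, ?_, ?_⟩
  · rw [hpow, ← Real.exp_add, ← Real.exp_add]
    apply hsix
    have := mul_le_mul_of_nonneg_right hqm (Nat.cast_nonneg (α := ℝ) m)
    linarith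
  · rw [hpow, mul_comm (n : ℝ), mul_assoc]
    nth_rewrite 1 [hnL]
    rw [← Real.exp_add, ← Real.exp_add]
    apply hsix
    push_cast
    have hhalf : (n : ℝ) / 2 ≤ n - (4 * m + 1) := by linarith
    have := mul_le_mul_of_nonneg_left hhalf (show 0 ≤ L ^ 2 / s by positivity)
    linarith
  · rw [mul_div_cancel_left₀ _ hs0.ne', le_div_iff₀ (by norm_num)]
    calc 5 * Real.exp (-w) * 6 = Real.exp (-w) * 30 := by ring
      _ ≤ Real.exp (-w) * Real.exp 4 := by gcongr
      _ = Real.exp (-w + 4) := (Real.exp_add _ _).symm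
      _ ≤ _ := Real.exp_le_exp.2 (by linarith)
  · rw [hqn]; linarith
  · linarith
  · linarith

end Asymptotics

lemma Next_Nred_bounds {n m : ℕ} {t : ℝ} {ω : Sym2 (Fin n) → Bool}
    (h1 : ∀ c, Linked (colorGraph n c ω) m m)
    (h2 : ∀ c, Linked (colorGraph n c ω) 1 (n - (4 * m + 1)))
    (h3 : ∑ v, degSign v ω < t) (h4 : -t < ∑ v, degSign v ω)
    (hmt : 4 * (m : ℝ) ≤ t) (hn : (n : ℝ) / 2 + t / 2 + 8 * m + 2 < n) :
    ((n : ℝ) / 4 - t ≤ Next (erGraph n ω) ∧ (Next (erGraph n ω) : ℝ) ≤ n / 4 + t) ∧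
      ((n : ℝ) / 4 - t ≤ Nred (erGraph n ω) ∧ (Nred (erGraph n ω) : ℝ) ≤ n / 4 + t) := by
  classical
  set T : Finset (Fin n) := {v | Odd (degN (erGraph n ω) v)} with hTdef
  have hT : ∀ v, v ∈ T ↔ Odd (degN (erGraph n ω) v) := by simp [hTdef]
  have hsum := sum_degSign ω T hT
  rw [hsum] at h3 h4
  have hm0 : (0 : ℝ) ≤ m := Nat.cast_nonneg m
  have hTn : T.card + 8 * m + 2 < n := by
    have : (T.card : ℝ) + 8 * m + 2 < n := by linarith
    exact_mod_cast this
  have hG : Linked (erGraph n ω) m m := h1 true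
  have hGc : Linked (erGraph n ω)ᶜ m m := by rw [← colorGraph_false]; exact h1 false
  have hd : ∀ v, 4 * m + 1 ≤ (erGraph n ω).degree v := Linked.le_degree
    (by rw [Fintype.card_fin]; exact h2 true) (by rw [Fintype.card_fin]; omega)
  have hdc : ∀ v, 4 * m + 1 ≤ (erGraph n ω)ᶜ.degree v := Linked.le_degree
    (by rw [Fintype.card_fin, ← colorGraph_false]; exact h2 false)
    (by rw [Fintype.card_fin]; omega)
  obtain ⟨a1, a2⟩ := two_mul_Next_mem hG hGc (fun v => le_trans (by omega) (hd v))
    (fun v => le_trans (by omega) (hdc v)) T hT (by rw [Fintype.card_fin]; omega)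
  obtain ⟨b1, b2⟩ := two_mul_Nred_mem hG hd T hT (by rw [Fintype.card_fin]; omega)
  have a1' : (T.card : ℝ) ≤ 2 * Next (erGraph n ω) := by exact_mod_cast a1
  have a2' : 2 * (Next (erGraph n ω) : ℝ) ≤ T.card + 6 * m := by exact_mod_cast a2
  have b1' : (T.card : ℝ) ≤ 2 * Nred (erGraph n ω) := by exact_mod_cast b1
  have b2' : 2 * (Nred (erGraph n ω) : ℝ) ≤ T.card + 6 * m := by exact_mod_cast b2
  refine ⟨⟨?_, ?_⟩, ?_, ?_⟩ <;> linarith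

/-- Deviation estimates for the Eulerian extension and reduction numbers: with
probability at least `1 - 1/n^r`, both `N_ext(G(n,p))` and `N_red(G(n,p))` lie
between `n/4 - n^(1/2+η)` and `n/4 + n^(1/2+η)`. -/
theorem ext_red_number_deviation (η : ℝ) (hη : 0 < η) (r : ℝ) (hr : 0 < r) :
    ∃ n0 : ℕ, ∀ n : ℕ, n0 ≤ n → ∀ p : ℝ,
      (Real.log n) ^ 2 / Real.sqrt n ≤ p → p ≤ 1 - (Real.log n) ^ 2 / Real.sqrt n →
      ENNReal.ofReal (1 - 1 / (n : ℝ) ^ r)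
        ≤ erMeasure n p {ω |
            ((n : ℝ) / 4 - (n : ℝ) ^ ((1 : ℝ) / 2 + η) ≤ (Next (erGraph n ω) : ℝ) ∧
              (Next (erGraph n ω) : ℝ) ≤ (n : ℝ) / 4 + (n : ℝ) ^ ((1 : ℝ) / 2 + η)) ∧
            ((n : ℝ) / 4 - (n : ℝ) ^ ((1 : ℝ) / 2 + η) ≤ (Nred (erGraph n ω) : ℝ) ∧
              (Nred (erGraph n ω) : ℝ) ≤ (n : ℝ) / 4 + (n : ℝ) ^ ((1 : ℝ) / 2 + η))} := by
  have hη'0 : 0 < min η (1 / 4) := lt_min hη (by norm_num)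
  obtain ⟨n0, hn0⟩ := Filter.eventually_atTop.1 (exists_parameter hη'0 (min_le_right _ _) hr)
  refine ⟨n0, fun n hn p hp1 hp2 => ?_⟩
  obtain ⟨hpos, m, hi, hii, hiii, hiv, hv, hvi⟩ := hn0 n hn
  set q := Real.log n ^ 2 / √n with hq
  set t := (n : ℝ) ^ (1 / 2 + min η (1 / 4)) with ht
  have hq0 : 0 ≤ q := by positivity
  have hprob := isProbabilityMeasure_erMeasure (n := n) (hq0.trans hp1) (by linarith : p ≤ 1)
  have htle : t ≤ (n : ℝ) ^ ((1 : ℝ) / 2 + η) :=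
    Real.rpow_le_rpow_of_exponent_le (by exact_mod_cast hpos) (by gcongr; exact min_le_left _ _)
  have hmn : 4 * m + 1 ≤ n := by
    have : 4 * (m : ℝ) + 1 ≤ n := by
      have : 0 < t := by positivity
      have hm0 : (0 : ℝ) ≤ m := Nat.cast_nonneg m
      linarith [(Nat.cast_nonneg n : (0 : ℝ) ≤ n)]
    exact_mod_cast this
  set B1 : Bool → Set (Sym2 (Fin n) → Bool) := fun c => {ω | ¬ Linked (colorGraph n c ω) m m}
  set B2 : Bool → Set (Sym2 (Fin n) → Bool) :=
    fun c => {ω | ¬ Linked (colorGraph n c ω) 1 (n - (4 * m + 1))}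
  set B3 : ℝ → Set (Sym2 (Fin n) → Bool) := fun σ => {ω | t ≤ σ * ∑ v, degSign v ω}
  have hB1 : ∀ c, (erMeasure n p).real (B1 c) ≤ 1 / (n : ℝ) ^ r / 6 := by
    intro c
    refine ((erMeasure_real_not_linked_le hq0 hp1 hp2 c m m).trans ?_).trans hi
    have : (n.choose m : ℝ) ≤ (n : ℝ) ^ m := by exact_mod_cast Nat.choose_le_pow n m
    gcongr
  have hB2 : ∀ c, (erMeasure n p).real (B2 c) ≤ 1 / (n : ℝ) ^ r / 6 := by
    intro c
    refine ((erMeasure_real_not_linked_le hq0 hp1 hp2 c 1 (n - (4 * m + 1))).trans ?_).trans hii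
    have : (n.choose (4 * m + 1) : ℝ) ≤ (n : ℝ) ^ (4 * m + 1) := by
      exact_mod_cast Nat.choose_le_pow n _
    rw [Nat.choose_symm hmn, Nat.choose_one_right, Nat.cast_sub hmn, Nat.cast_one, one_mul]
    push_cast
    gcongr
  have hB3 : ∀ σ, |σ| = 1 → (erMeasure n p).real (B3 σ) ≤ 1 / (n : ℝ) ^ r / 6 := fun σ hσ =>
    (erMeasure_real_sum_degSign_ge_le hpos hq0 hp1 hp2 hiv t hσ).trans hiii
  set S := {ω | ((n : ℝ) / 4 - (n : ℝ) ^ ((1 : ℝ) / 2 + η) ≤ (Next (erGraph n ω) : ℝ) ∧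
              (Next (erGraph n ω) : ℝ) ≤ (n : ℝ) / 4 + (n : ℝ) ^ ((1 : ℝ) / 2 + η)) ∧
            ((n : ℝ) / 4 - (n : ℝ) ^ ((1 : ℝ) / 2 + η) ≤ (Nred (erGraph n ω) : ℝ) ∧
              (Nred (erGraph n ω) : ℝ) ≤ (n : ℝ) / 4 + (n : ℝ) ^ ((1 : ℝ) / 2 + η))} with hS
  have hcover : Set.univ ⊆ S ∪ ((B1 true ∪ B1 false) ∪ (B2 true ∪ B2 false) ∪
      (B3 1 ∪ B3 (-1))) := by
    intro ω _
    by_contra hω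
    have hω' : ω ∉ S ∧ ((Linked (colorGraph n true ω) m m ∧ Linked (colorGraph n false ω) m m) ∧
        (Linked (colorGraph n true ω) 1 (n - (4 * m + 1)) ∧
          Linked (colorGraph n false ω) 1 (n - (4 * m + 1)))) ∧
        (1 * ∑ v, degSign v ω < t ∧ -1 * ∑ v, degSign v ω < t) := by
      simpa only [B1, B2, B3, Set.mem_union, Set.mem_ofPred_eq, not_or, not_not, not_le] using hω
    obtain ⟨hnS, ⟨⟨l1, l2⟩, l3, l4⟩, l5, l6⟩ := hω'
    apply hnS
    obtain ⟨⟨c1, c2⟩, c3, c4⟩ := Next_Nred_bounds (Bool.forall_bool.2 ⟨l2, l1⟩)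
      (Bool.forall_bool.2 ⟨l4, l3⟩) (by linarith) (by linarith) hv hvi
    exact ⟨⟨by linarith, by linarith⟩, by linarith, by linarith⟩
  apply ENNReal.ofReal_le_of_le_toReal
  change _ ≤ (erMeasure n p).real S
  have u0 := measureReal_mono (μ := erMeasure n p) hcover
  rw [probReal_univ] at u0
  have u1 := measureReal_union_le (μ := erMeasure n p) S ((B1 true ∪ B1 false) ∪
    (B2 true ∪ B2 false) ∪ (B3 1 ∪ B3 (-1)))
  have u2 := measureReal_union_le (μ := erMeasure n p) ((B1 true ∪ B1 false) ∪
    (B2 true ∪ B2 false)) (B3 1 ∪ B3 (-1))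
  have u3 := measureReal_union_le (μ := erMeasure n p) (B1 true ∪ B1 false)
    (B2 true ∪ B2 false)
  have u4 := measureReal_union_le (μ := erMeasure n p) (B1 true) (B1 false)
  have u5 := measureReal_union_le (μ := erMeasure n p) (B2 true) (B2 false)
  have u6 := measureReal_union_le (μ := erMeasure n p) (B3 1) (B3 (-1))
  linarith [hB1 true, hB1 false, hB2 true, hB2 false, hB3 1 (by simp), hB3 (-1) (by simp)]
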